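/- If C is locally presentable, K is a small category, and F : K → C is a functor, then the category C^m of K-marked objects of C is locally presentable. -/

import Mathlib

open CategoryTheory Limits

universe w v u

/-- A `K`-marked object of `C`: an object together with a subfunctor of `Hom(F(-), X)`. -/
structure MarkedObj {C : Type u} [Category.{v} C] {K : Type w} [Category.{v} K]
    (F : K ⥤ C) where
  pt : C
  marked : ∀ k : K, Set (F.obj k ⟶ pt)
  comp_mem : ∀ {k k' : K} (g : k ⟶ k') {f : F.obj k' ⟶ pt},
    f ∈ marked k' → F.map g ≫ f ∈ marked k

namespace MarkedObj

variable {C : Type u} [Category.{v} C] {K : Type w} [Category.{v} K] {F : K ⥤ C}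

/-- Morphisms of marked objects preserve marked maps. -/
@[ext]
structure Hom (A B : MarkedObj F) where
  hom : A.pt ⟶ B.pt
  pres : ∀ ⦃k : K⦄ ⦃e : F.obj k ⟶ A.pt⦄, e ∈ A.marked k → e ≫ hom ∈ B.marked k

instance : Category (MarkedObj F) where
  Hom := Hom
  id A := ⟨𝟙 _, fun k e he => by simpa using he⟩
  comp f g := ⟨f.hom ≫ g.hom, fun k e he => by
    simpa [Category.assoc] using g.pres (f.pres he)⟩
  id_comp f := by apply Hom.ext; simp [CategoryStruct.id, CategoryStruct.comp]
  comp_id f := by apply Hom.ext; simp [CategoryStruct.id, CategoryStruct.comp]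
  assoc f g h := by apply Hom.ext; simp [CategoryStruct.comp]

@[simp] lemma id_hom (A : MarkedObj F) : Hom.hom (𝟙 A) = 𝟙 A.pt := rfl
@[simp] lemma comp_hom {A B D : MarkedObj F} (f : A ⟶ B) (g : B ⟶ D) :
    (f ≫ g).hom = f.hom ≫ g.hom := rfl

/-- The forgetful functor. -/
def forget (F : K ⥤ C) : MarkedObj F ⥤ C where
  obj A := A.pt
  map f := f.hom

/-- The flat marked object: no maps are marked. -/
def flatObj (F : K ⥤ C) (X : C) : MarkedObj F :=
  ⟨X, fun _ => ∅, by intro k k' g f h; exact h.elim⟩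

/-- The flat functor, left adjoint to `forget`. -/
def flat (F : K ⥤ C) : C ⥤ MarkedObj F where
  obj X := flatObj F X
  map f := ⟨f, by intro k e h; exact h.elim⟩

/-- The sharp marked object: all maps are marked. -/
def sharpObj (F : K ⥤ C) (X : C) : MarkedObj F :=
  ⟨X, fun _ => Set.univ, by intro k k' g f _; trivial⟩

/-- The sharp functor, right adjoint to `forget`. -/
def sharp (F : K ⥤ C) : C ⥤ MarkedObj F where
  obj X := sharpObj F X
  map f := ⟨f, by intro k e _; trivial⟩

end MarkedObj


/-- A category `J` is `κ`-filtered if every diagram indexed by a category with fewer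
than `κ` objects and fewer than `κ` morphisms admits a cocone. -/
def IsCardFiltered (J : Type v) [Category.{v} J] (κ : Cardinal.{v}) : Prop :=
  ∀ (A : Type v) (_ : SmallCategory A), Cardinal.mk A < κ →
    Cardinal.mk (Σ a b : A, a ⟶ b) < κ →
    ∀ G : A ⥤ J, Nonempty (Limits.Cocone G)

/-- An object `X` is `κ`-presentable if `Hom(X, -)` preserves `κ`-filtered colimits. -/
def IsPresentableObj {C : Type u} [Category.{v} C] (κ : Cardinal.{v}) (X : C) : Prop :=
  ∀ (J : Type v) (_ : SmallCategory J), IsCardFiltered J κ →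
    Nonempty (PreservesColimitsOfShape J (coyoneda.obj (Opposite.op X)))

/-- A category is locally presentable if it is cocomplete and, for some regular
cardinal `κ`, there is a (small) set of `κ`-presentable objects such that every
object is a `κ`-filtered colimit of objects from this set. -/
def LocallyPresentable (C : Type u) [Category.{v} C] : Prop :=
  HasColimits C ∧ ∃ κ : Cardinal.{v}, κ.IsRegular ∧ ∃ S : Set C, Small.{v} S ∧
    (∀ X ∈ S, IsPresentableObj κ X) ∧
    ∀ X : C, ∃ (J : Type v) (_ : SmallCategory J) (D : J ⥤ C) (c : Cocone D)
      (_ : IsColimit c), IsCardFiltered J κ ∧ (∀ j, D.obj j ∈ S) ∧ c.pt = X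

namespace MarkedObj

section

variable {C : Type u} [Category.{v} C] {K : Type w} [Category.{v} K] (F : K ⥤ C)

variable {F} in
lemma hom_ext {A B : MarkedObj F} {f g : A ⟶ B} (h : f.hom = g.hom) : f = g := Hom.ext h

variable {F} in
/-- The morphism out of `flatObj F X` given by a morphism out of `X`. -/
def flatObjDesc {X : C} {A : MarkedObj F} (e : X ⟶ A.pt) : flatObj F X ⟶ A :=
  ⟨e, by intro k e h; exact h.elim⟩

/-- The flat functor is left adjoint to the forgetful functor. -/
def flatAdjunction : flat F ⊣ forget F :=
  Adjunction.mkOfHomEquiv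
    { homEquiv := fun _ _ =>
        { toFun := fun f => f.hom
          invFun := flatObjDesc
          left_inv := fun _ => rfl
          right_inv := fun _ => rfl }
      homEquiv_naturality_left_symm := fun _ _ => rfl
      homEquiv_naturality_right := fun _ _ => rfl }

/-- The sharp functor is right adjoint to the forgetful functor. -/
def sharpAdjunction : forget F ⊣ sharp F :=
  Adjunction.mkOfHomEquiv
    { homEquiv := fun _ _ =>
        { toFun := fun f => ⟨f, by intro k e _; trivial⟩
          invFun := fun f => f.hom
          left_inv := fun _ => rfl
          right_inv := fun _ => rfl }
      homEquiv_naturality_left_symm := fun _ _ => rfl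
      homEquiv_naturality_right := fun _ _ => rfl }

instance : (forget F).IsRightAdjoint := (flatAdjunction F).isRightAdjoint

instance : (forget F).IsLeftAdjoint := (sharpAdjunction F).isLeftAdjoint

variable {F}

section Colimits

variable {J : Type*} [Category* J] {D : J ⥤ MarkedObj F}

/-- A cocone on the underlying objects lifts to marked objects: mark on its point
exactly the maps that come from a marked map of some object of the diagram. -/
def imageCocone (c : Cocone (D ⋙ forget F)) : Cocone D where
  pt :=
    { pt := c.pt
      marked := fun k => {e | ∃ (j : J) (e' : F.obj k ⟶ (D.obj j).pt),
        e' ∈ (D.obj j).marked k ∧ e' ≫ c.ι.app j = e}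
      comp_mem := by
        rintro k k' g _ ⟨j, e', he', rfl⟩
        exact ⟨j, F.map g ≫ e', (D.obj j).comp_mem g he', Category.assoc _ _ _⟩ }
  ι :=
    { app := fun j => ⟨c.ι.app j, fun _ e' he' => ⟨j, e', he', rfl⟩⟩
      naturality := fun _ _ f => hom_ext (c.ι.naturality f) }

/-- The lift of a colimit cocone is a colimit cocone. -/
def isColimitImageCocone {c : Cocone (D ⋙ forget F)} (hc : IsColimit c) :
    IsColimit (imageCocone c) where
  desc s :=
    ⟨hc.desc ((forget F).mapCocone s), by
      rintro k _ ⟨j, e', he', rfl⟩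
      have h : c.ι.app j ≫ hc.desc ((forget F).mapCocone s) = (s.ι.app j).hom :=
        hc.fac ((forget F).mapCocone s) j
      exact ((Category.assoc _ _ _).trans (congrArg (e' ≫ ·) h)).symm ▸ (s.ι.app j).pres he'⟩
  fac s j := hom_ext (hc.fac ((forget F).mapCocone s) j)
  uniq s m hm := hom_ext (hc.uniq ((forget F).mapCocone s) m.hom
    fun j => congrArg Hom.hom (hm j))

instance [HasColimitsOfShape J C] : HasColimitsOfShape J (MarkedObj F) where
  has_colimit _ := ⟨⟨_, isColimitImageCocone (colimit.isColimit _)⟩⟩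

lemma exists_marked_of_isColimit {c : Cocone D} (hc : IsColimit c) {k : K}
    {e : F.obj k ⟶ c.pt.pt} (he : e ∈ c.pt.marked k) :
    ∃ (j : J) (e' : F.obj k ⟶ (D.obj j).pt),
      e' ∈ (D.obj j).marked k ∧ e' ≫ (c.ι.app j).hom = e := by
  let d := imageCocone ((forget F).mapCocone c)
  have h : (hc.desc d).hom = 𝟙 c.pt.pt := by
    let p : d.pt ⟶ c.pt := ⟨𝟙 c.pt.pt, by
      rintro k e ⟨j, e', he', rfl⟩
      exact (Category.comp_id (e' ≫ (c.ι.app j).hom)).symm ▸ (c.ι.app j).pres he'⟩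
    have hp : hc.desc d ≫ p = 𝟙 c.pt := hc.hom_ext fun j => by
      rw [hc.fac_assoc]
      exact hom_ext ((Category.comp_id (c.ι.app j).hom).trans
        (Category.comp_id (c.ι.app j).hom).symm)
    exact (Category.comp_id _).symm.trans (congrArg Hom.hom hp)
  obtain ⟨j, e', he', hj⟩ := (hc.desc d).pres he
  exact ⟨j, e', he', hj.trans ((congrArg (e ≫ ·) h).trans (Category.comp_id e))⟩

end Colimits

variable (F) in
/-- The marked object freely generated by a single marked map from `F.obj k`. -/
def freeObj (k : K) : MarkedObj F where
  pt := F.obj k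
  marked k' := {e | ∃ g : k' ⟶ k, F.map g = e}
  comp_mem := by
    rintro _ _ g _ ⟨g', rfl⟩
    exact ⟨g ≫ g', F.map_comp g g'⟩

/-- The morphism out of `freeObj F k` classifying a marked map. -/
def freeObjDesc {k : K} {A : MarkedObj F} {e : F.obj k ⟶ A.pt} (he : e ∈ A.marked k) :
    freeObj F k ⟶ A :=
  ⟨e, by
    rintro k' _ ⟨g, rfl⟩
    exact A.comp_mem g he⟩

lemma mem_marked_of_freeObj_hom {k : K} {A : MarkedObj F} (f : freeObj F k ⟶ A) :
    (show F.obj k ⟶ A.pt from f.hom) ∈ A.marked k :=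
  Category.id_comp (show F.obj k ⟶ A.pt from f.hom) ▸
    f.pres (e := 𝟙 (F.obj k)) ⟨𝟙 k, F.map_id k⟩

lemma isCardinalPresentable_flatObj {κ : Cardinal.{v}} [Fact κ.IsRegular] (X : C)
    [IsCardinalPresentable X κ] : IsCardinalPresentable (flatObj F X) κ :=
  (flatAdjunction F).isCardinalPresentable_leftAdjoint_obj κ X

lemma isCardinalPresentable_freeObj {κ : Cardinal.{v}} [Fact κ.IsRegular] (k : K)
    [IsCardinalPresentable (F.obj k) κ] : IsCardinalPresentable (freeObj F k) κ where
  preservesColimitOfShape J _ _ :=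
    { preservesColimit {D} :=
        { preserves {c} hc := ⟨Types.FilteredColimit.isColimitOf _ _
            (fun (f : freeObj F k ⟶ c.pt) => by
              obtain ⟨j, e, he, hf⟩ := exists_marked_of_isColimit hc (mem_marked_of_freeObj_hom f)
              exact ⟨j, freeObjDesc he, hom_ext hf.symm⟩)
            (fun i j (f : freeObj F k ⟶ D.obj i) (g : freeObj F k ⟶ D.obj j) h => by
              obtain ⟨l, a, b, hab⟩ := IsCardinalPresentable.exists_eq_of_isColimit κ
                (isColimitOfPreserves (forget F) hc) (X := F.obj k) f.hom g.hom
                (congrArg Hom.hom h)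
              exact ⟨l, a, b, hom_ext hab⟩)⟩ } }

lemma isIso_of_isIso_hom {A B : MarkedObj F} (i : A ⟶ B) [IsIso i.hom]
    (hi : ∀ ⦃k : K⦄ ⦃e : F.obj k ⟶ B.pt⦄, e ∈ B.marked k → e ≫ inv i.hom ∈ A.marked k) :
    IsIso i :=
  ⟨⟨inv i.hom, hi⟩, hom_ext (IsIso.hom_inv_id i.hom), hom_ext (IsIso.inv_hom_id i.hom)⟩

lemma isStrongGenerator_ofObj_flatObj_sup_ofObj_freeObj {P : ObjectProperty C}
    (hP : P.IsStrongGenerator) :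
    (ObjectProperty.ofObj (fun X : Subtype P => flatObj F X.1) ⊔
      ObjectProperty.ofObj (freeObj F)).IsStrongGenerator := by
  rw [ObjectProperty.isStrongGenerator_iff]
  refine ⟨fun A B f g hfg => hom_ext (hP.isSeparating _ _ fun X hX e => ?_),
    fun A B i _ hi => ?_⟩
  · exact congrArg Hom.hom (hfg _ (Or.inl ⟨⟨X, hX⟩⟩) (flatObjDesc e))
  · have : Mono i.hom := inferInstanceAs (Mono ((forget F).map i))
    have : IsIso i.hom := hP.isIso_of_mono i.hom fun X hX e => by
      obtain ⟨f, hf⟩ := hi _ (Or.inl ⟨⟨X, hX⟩⟩) (flatObjDesc e)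
      exact ⟨f.hom, congrArg Hom.hom hf⟩
    refine isIso_of_isIso_hom i fun k e he => ?_
    obtain ⟨f, hf⟩ := hi _ (Or.inr ⟨k⟩) (freeObjDesc he)
    have hfe : (show F.obj k ⟶ A.pt from f.hom) ≫ i.hom = e := congrArg Hom.hom hf
    rw [← hfe, Category.assoc, IsIso.hom_inv_id, Category.comp_id]
    exact mem_marked_of_freeObj_hom f

end

lemma isCardinalLocallyPresentable {C : Type u} [Category.{v} C] {K : Type v} [SmallCategory K]
    (F : K ⥤ C) (κ : Cardinal.{v}) [Fact κ.IsRegular] [IsCardinalLocallyPresentable C κ]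
    (hF : ∀ k, IsCardinalPresentable (F.obj k) κ) :
    IsCardinalLocallyPresentable (MarkedObj F) κ := by
  obtain ⟨P, _, hP, hPκ⟩ :=
    (IsCardinalLocallyPresentable.iff_exists_isStrongGenerator C κ).1 inferInstance
  have : HasColimitsOfSize.{v, v} (MarkedObj F) := ⟨fun _ _ => inferInstance⟩
  refine (IsCardinalLocallyPresentable.iff_exists_isStrongGenerator _ κ).2
    ⟨_, inferInstance, isStrongGenerator_ofObj_flatObj_sup_ofObj_freeObj hP, ?_⟩
  rintro _ (⟨⟨X, hX⟩⟩ | h)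
  · have : IsCardinalPresentable X κ := hPκ _ hX
    exact isCardinalPresentable_flatObj X
  · obtain ⟨k, rfl⟩ := (ObjectProperty.ofObj_iff _ _).1 h
    have := hF k
    exact isCardinalPresentable_freeObj k

end MarkedObj

lemma exists_regular_cardinal_isCardinalPresentable {C : Type u} [Category.{v} C] {K : Type v}
    (X : K → C) (hX : ∀ k, IsPresentable.{v} (X k)) (κ : Cardinal.{v}) :
    ∃ (κ' : Cardinal.{v}) (_ : Fact κ'.IsRegular), κ ≤ κ' ∧
      ∀ k, IsCardinalPresentable (X k) κ' := by
  choose μ hμ hXμ using fun k => (hX k).exists_cardinal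
  obtain ⟨κ', hκ', hlt⟩ := HasCardinalLT.exists_regular_cardinal_forall.{v}
    (fun k : Option K => (k.elim κ μ).ord.ToType)
  have hle (k : Option K) : k.elim κ μ ≤ κ' :=
    le_of_lt (by simpa [hasCardinalLT_iff_cardinal_mk_lt] using hlt k)
  have : Fact κ'.IsRegular := ⟨hκ'⟩
  exact ⟨κ', this, hle none, fun k =>
    isCardinalPresentable_of_le _ (show μ k ≤ κ' from hle (some k))⟩

lemma isCardFiltered_iff (J : Type v) [SmallCategory J] (κ : Cardinal.{v}) [Fact κ.IsRegular] :
    IsCardFiltered J κ ↔ IsCardinalFiltered J κ := by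
  have key (A : Type v) [SmallCategory A] :
      HasCardinalLT (Arrow A) κ ↔ Cardinal.mk (Σ a b : A, a ⟶ b) < κ := by
    rw [← hasCardinalLT_iff_cardinal_mk_lt]
    exact hasCardinalLT_iff_of_equiv
      { toFun := fun f => ⟨f.left, f.right, f.hom⟩
        invFun := fun f => Arrow.mk f.2.2
        left_inv := fun _ => rfl
        right_inv := fun _ => rfl } κ
  refine ⟨fun h => ⟨fun {A} _ G hA => ?_⟩, fun _ A _ _ hA G => ?_⟩
  · exact h A _ ((hasCardinalLT_iff_cardinal_mk_lt _ _).1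
      (hasCardinalLT_of_hasCardinalLT_arrow hA)) ((key A).1 hA) G
  · exact IsCardinalFiltered.nonempty_cocone G ((key A).2 hA)

lemma isPresentableObj_iff {C : Type u} [Category.{v} C] (κ : Cardinal.{v}) [Fact κ.IsRegular]
    (X : C) : IsPresentableObj κ X ↔ IsCardinalPresentable X κ :=
  ⟨fun h => ⟨fun J _ hJ => (h J _ ((isCardFiltered_iff J κ).2 hJ)).some⟩,
    fun h J _ hJ => ⟨by
      have := (isCardFiltered_iff J κ).1 hJ
      exact h.preservesColimitOfShape J⟩⟩

lemma locallyPresentable_iff (C : Type u) [Category.{v} C] :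
    LocallyPresentable C ↔
      ∃ (κ : Cardinal.{v}) (_ : Fact κ.IsRegular), IsCardinalLocallyPresentable C κ := by
  constructor
  · rintro ⟨_, κ, hκ, S, hS, hSκ, hC⟩
    have : Fact κ.IsRegular := ⟨hκ⟩
    let P : ObjectProperty C := fun X => X ∈ S
    have : ObjectProperty.Small.{v} P := hS
    have hP : P.IsCardinalFilteredGenerator κ :=
      { le_isCardinalPresentable := fun X hX => (isPresentableObj_iff κ X).1 (hSκ X hX)
        exists_colimitsOfShape := fun X => by
          obtain ⟨J, _, D, c, hc, hJ, hD, rfl⟩ := hC X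
          exact ⟨J, inferInstance, (isCardFiltered_iff J κ).1 hJ,
            ⟨{ diag := D, ι := c.ι, isColimit := hc, prop_diag_obj := hD }⟩⟩ }
    have := hP.hasCardinalFilteredGenerator
    exact ⟨κ, inferInstance, { }⟩
  · rintro ⟨κ, hκ, _⟩
    obtain ⟨P, hP, hPκ⟩ := HasCardinalFilteredGenerator.exists_small_generator C κ
    refine ⟨inferInstance, κ, hκ.out, {X | P X}, hP,
      fun X hX => (isPresentableObj_iff κ X).2 (hPκ.le_isCardinalPresentable X hX), fun X => ?_⟩
    obtain ⟨J, _, hJ, ⟨p⟩⟩ := hPκ.exists_colimitsOfShape X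
    exact ⟨J, inferInstance, p.diag, _, p.isColimit, (isCardFiltered_iff J κ).2 hJ,
      p.prop_diag_obj, rfl⟩

/-- if `C` is locally presentable, `K` is a small category and
`F : K ⥤ C` is a functor, then the category of `K`-marked objects of `C` is
locally presentable. -/
theorem markedObj_locallyPresentable {C : Type u} [Category.{v} C] {K : Type v}
    [SmallCategory K] (F : K ⥤ C) (h : LocallyPresentable C) :
    LocallyPresentable (MarkedObj F) := by
  rw [locallyPresentable_iff] at h ⊢
  obtain ⟨κ, _, _⟩ := h
  have : IsLocallyPresentable.{v} C := ⟨κ, inferInstance, inferInstance⟩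
  obtain ⟨κ', _, hκ', hF⟩ :=
    exists_regular_cardinal_isCardinalPresentable F.obj (fun _ => inferInstance) κ
  have := IsCardinalLocallyPresentable.of_le C hκ'
  exact ⟨κ', inferInstance, MarkedObj.isCardinalLocallyPresentable F κ' hF⟩
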